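/- Let $\Omega$ be a bounded domain in $\mathbb{C}^n$ with the Euclidean Kähler form $\omega$, let $f > 0$ be continuous on $\overline\Omega$, and suppose $(\lambda_1, u)$ solves the eigenvalue problem $(\sqrt{-1}\partial\bar\partial u)^m \wedge \omega^{n-m} = (-\lambda_1 u)^m f^m \omega^n$ with $u \in m\mathrm{SH}(\Omega) \cap C^2(\Omega) \cap C^0(\overline\Omega)$, $u = 0$ on $\partial\Omega$, $\inf_\Omega u = -1$. Then $\lambda_1 \ge \frac{1}{2}\,\omega_{2n}^{1/2n}\, \mathrm{diam}(\Omega)^{-1}\, \|f\|_{L^{2n}(\Omega)}^{-1}$, where $\omega_{2n}$ is the volume of the unit ball in $\mathbb{C}^n$. -/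

import Mathlib

open MeasureTheory Finset

/-- The `k`-th elementary symmetric polynomial of `lam : Fin n → ℝ`. -/
noncomputable def esymmR (n k : ℕ) (lam : Fin n → ℝ) : ℝ :=
  ∑ s ∈ Finset.powersetCard k (Finset.univ : Finset (Fin n)), ∏ i ∈ s, lam i

/-- The Wirtinger derivative `∂g/∂z_j` of `g : ℂⁿ → ℂ`. -/
noncomputable def wDeriv {n : ℕ} (j : Fin n) (g : EuclideanSpace ℂ (Fin n) → ℂ)
    (x : EuclideanSpace ℂ (Fin n)) : ℂ :=
  (1 / 2) * (fderiv ℝ g x (EuclideanSpace.single j 1) -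
    Complex.I * fderiv ℝ g x (EuclideanSpace.single j Complex.I))

/-- The conjugate Wirtinger derivative `∂g/∂z̄_i` of `g : ℂⁿ → ℂ`. -/
noncomputable def wBarDeriv {n : ℕ} (i : Fin n) (g : EuclideanSpace ℂ (Fin n) → ℂ)
    (x : EuclideanSpace ℂ (Fin n)) : ℂ :=
  (1 / 2) * (fderiv ℝ g x (EuclideanSpace.single i 1) +
    Complex.I * fderiv ℝ g x (EuclideanSpace.single i Complex.I))

/-- The complex Hessian matrix `(∂²u/∂z_i∂z̄_j)` of a real-valued `u : ℂⁿ → ℝ`. -/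
noncomputable def complexHessian {n : ℕ} (u : EuclideanSpace ℂ (Fin n) → ℝ)
    (x : EuclideanSpace ℂ (Fin n)) : Matrix (Fin n) (Fin n) ℂ :=
  fun i j => wBarDeriv i (wDeriv j (fun z => (u z : ℂ))) x

lemma amgm_pow {ι : Type*} (s : Finset ι) (hs : s.Nonempty) (z : ι → ℝ) (hz : ∀ i ∈ s, 0 ≤ z i) :
    ∏ i ∈ s, z i ≤ ((∑ i ∈ s, z i) / s.card) ^ s.card := by
  have hc : (s.card : ℝ) ≠ 0 := by exact_mod_cast hs.card_pos.ne'
  have h := Real.geom_mean_le_arith_mean s (fun _ => 1) z (by simp) (by simpa using hs) hz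
  simp only [Real.rpow_one, one_mul, sum_const, nsmul_eq_mul, mul_one] at h
  have h2 := pow_le_pow_left₀ (Real.rpow_nonneg (Finset.prod_nonneg hz) _) h s.card
  rwa [← Real.rpow_natCast, ← Real.rpow_mul (Finset.prod_nonneg hz), inv_mul_cancel₀ hc,
    Real.rpow_one] at h2

lemma prod_powersetCard_prod {n m : ℕ} (hm : 1 ≤ m) (lam : Fin n → ℝ) :
    ∏ s ∈ powersetCard m (univ : Finset (Fin n)), ∏ i ∈ s, lam i
      = (∏ i, lam i) ^ ((n-1).choose (m-1)) := by
  have h1 : ∀ s ∈ powersetCard m (univ : Finset (Fin n)), ∏ i ∈ s, lam i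
      = ∏ i, if i ∈ s then lam i else 1 := by
    intro s _
    simp [Finset.prod_ite_mem]
  rw [Finset.prod_congr rfl h1, Finset.prod_comm, ← Finset.prod_pow]
  refine Finset.prod_congr rfl fun i _ => ?_
  rw [Finset.prod_ite]
  simp only [prod_const, one_pow, mul_one]
  congr 1
  obtain ⟨k, rfl⟩ : ∃ k, m = k + 1 := ⟨m - 1, by omega⟩
  have : (powersetCard (k+1) (univ : Finset (Fin n))).filter (fun s => i ∈ s)
      = (powersetCard k ((univ : Finset (Fin n)).erase i)).image (insert i) := by
    ext s
    simp only [mem_filter, mem_powersetCard, mem_image, subset_univ, true_and]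
    constructor
    · rintro ⟨hc, hi⟩
      exact ⟨s.erase i, ⟨Finset.erase_subset_erase _ (subset_univ _), by
        rw [Finset.card_erase_of_mem hi, hc]; rfl⟩, Finset.insert_erase hi⟩
    · rintro ⟨t, ⟨ht, hc⟩, rfl⟩
      have : i ∉ t := fun h => by simpa using ht h
      exact ⟨by rw [Finset.card_insert_of_notMem this, hc], Finset.mem_insert_self _ _⟩
  rw [this, Finset.card_image_of_injOn, card_powersetCard]
  · simp
  · intro s hs t ht h
    have hs' : i ∉ s := fun h => by simpa using (mem_powersetCard.1 hs).1 h
    have ht' : i ∉ t := fun h => by simpa using (mem_powersetCard.1 ht).1 h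
    have := congrArg (fun a => Finset.erase a i) h
    simpa [hs', ht'] using this

lemma maclaurin_prod {n m : ℕ} (hm : 1 ≤ m) (hmn : m ≤ n) (lam : Fin n → ℝ) (hl : ∀ i, 0 ≤ lam i)
    (t : ℝ) (ht : 0 ≤ t) (h : esymmR n m lam = (n.choose m : ℝ) * t ^ m) :
    ∏ i, lam i ≤ t ^ n := by
  have hc : 0 < n.choose m := Nat.choose_pos hmn
  have hcard : (powersetCard m (univ : Finset (Fin n))).card = n.choose m := by simp
  have h1 := amgm_pow (powersetCard m (univ : Finset (Fin n)))
    (Finset.card_pos.1 (by rw [hcard]; exact hc)) (fun s => ∏ i ∈ s, lam i)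
    (fun s _ => Finset.prod_nonneg fun i _ => hl i)
  rw [prod_powersetCard_prod hm, hcard] at h1
  unfold esymmR at h
  rw [h, mul_div_cancel_left₀ _ (by exact_mod_cast hc.ne'), ← pow_mul] at h1
  have hid : m * n.choose m = n * (n-1).choose (m-1) := by
    obtain ⟨k, rfl⟩ : ∃ k, m = k + 1 := ⟨m - 1, by omega⟩
    obtain ⟨l, rfl⟩ : ∃ l, n = l + 1 := ⟨n - 1, by omega⟩
    have := Nat.add_one_mul_choose_eq l k
    simp only [Nat.add_sub_cancel]
    rw [this]; ring
  rw [hid, pow_mul] at h1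
  have hc' : (n-1).choose (m-1) ≠ 0 := (Nat.choose_pos (by omega)).ne'
  exact le_of_pow_le_pow_left₀ hc' (by positivity) h1

lemma hadamard_posSemidef {ι : Type*} [Fintype ι] [DecidableEq ι] (G : Matrix ι ι ℝ)
    (hG : G.PosSemidef) : G.det ≤ ∏ i, G i i := by
  rcases isEmpty_or_nonempty ι with he | he
  · simp
  by_cases h0 : G.det = 0
  · rw [h0]; exact Finset.prod_nonneg fun i _ => hG.diag_nonneg
  have hpd : G.PosDef := hG.posDef_iff_isUnit.2 ((Matrix.isUnit_iff_isUnit_det _).2 (Ne.isUnit h0))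
  have hd : ∀ i, 0 < G i i := fun i => hpd.diag_pos
  set D : Matrix ι ι ℝ := Matrix.diagonal fun i => (Real.sqrt (G i i))⁻¹ with hD
  have hK : (D.conjTranspose * G * D).PosSemidef := hG.conjTranspose_mul_mul_same D
  set K := D.conjTranspose * G * D with hKdef
  have hKd : ∀ i, K i i = 1 := by
    intro i
    have := Real.mul_self_sqrt (hd i).le
    have h' := (Real.sqrt_pos.2 (hd i)).ne'
    simp only [hKdef, hD, Matrix.diagonal_conjTranspose, Matrix.mul_diagonal, Matrix.diagonal_mul]
    simp only [Pi.star_apply, star_trivial]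
    field_simp
    rw [sq, this]
  have htr : K.trace = Fintype.card ι := by simp [Matrix.trace, hKd]
  have hdet : K.det = (∏ i, G i i)⁻¹ * G.det := by
    simp only [hKdef, hD, Matrix.det_mul, Matrix.det_conjTranspose, Matrix.det_diagonal, star_trivial]
    rw [mul_right_comm, ← Finset.prod_mul_distrib, ← Finset.prod_inv_distrib]
    congr 1
    refine Finset.prod_congr rfl fun i _ => ?_
    rw [← mul_inv, Real.mul_self_sqrt (hd i).le]
  have hle : K.det ≤ 1 := by
    have h1 := hK.1.det_eq_prod_eigenvalues
    have h2 := hK.1.trace_eq_sum_eigenvalues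
    simp only [RCLike.ofReal_real_eq_id, id] at h1 h2
    have h3 := amgm_pow univ univ_nonempty hK.1.eigenvalues (fun i _ => hK.eigenvalues_nonneg i)
    rw [← h2, htr, ← h1] at h3
    simpa using h3
  rw [hdet, inv_mul_le_iff₀ (Finset.prod_pos fun i _ => hd i), mul_one] at hle
  exact hle

section
variable {E : Type*} [NormedAddCommGroup E] [InnerProductSpace ℝ E] [FiniteDimensional ℝ E]

/-- The inverse Riesz map as a real continuous linear map. -/
noncomputable def rieszInv : StrongDual ℝ E →L[ℝ] E :=
  LinearMap.toContinuousLinearMap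
    { toFun := fun l => (InnerProductSpace.toDual ℝ E).symm l
      map_add' := fun a b => map_add _ a b
      map_smul' := fun c a => by simp }

lemma inner_rieszInv (l : StrongDual ℝ E) (w : E) : inner ℝ (rieszInv l) w = l w :=
  InnerProductSpace.toDual_symm_apply (𝕜 := ℝ) (E := E) (x := w) (y := l)

/-- The operator representing a bilinear form through the inner product. -/
noncomputable def hessOp (H : E →L[ℝ] E →L[ℝ] ℝ) : E →L[ℝ] E := rieszInv.comp H

lemma inner_hessOp (H : E →L[ℝ] E →L[ℝ] ℝ) (v w : E) : inner ℝ (hessOp H v) w = H v w :=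
  inner_rieszInv (H v) w

lemma abs_det_hessOp_le {ι : Type*} [Fintype ι] [DecidableEq ι] (b : OrthonormalBasis ι ℝ E)
    (H : E →L[ℝ] E →L[ℝ] ℝ) (hs : ∀ v w, H v w = H w v) (hp : ∀ v, 0 ≤ H v v) :
    |(hessOp H).det| ≤ ∏ i, H (b i) (b i) := by
  set G : Matrix ι ι ℝ := LinearMap.toMatrix b.toBasis b.toBasis (hessOp H : E →ₗ[ℝ] E) with hGdef
  have hG : ∀ i j, G i j = H (b j) (b i) := by
    intro i j
    rw [hGdef, LinearMap.toMatrix_apply]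
    simp only [OrthonormalBasis.coe_toBasis, OrthonormalBasis.coe_toBasis_repr_apply,
      OrthonormalBasis.repr_apply_apply]
    rw [real_inner_comm]
    exact inner_hessOp H _ _
  have hdet : (hessOp H).det = G.det := by
    rw [hGdef, LinearMap.det_toMatrix]
  have hps : G.PosSemidef := by
    refine .of_dotProduct_mulVec_nonneg ?_ fun x => ?_
    · ext i j
      simp [hG, hs (b i) (b j)]
    · have : star x ⬝ᵥ G.mulVec x = H (∑ i, x i • b i) (∑ i, x i • b i) := by
        simp only [dotProduct, Matrix.mulVec, map_sum, map_smul, hG, Pi.star_apply, star_trivial,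
          FunLike.coe_sum, Finset.sum_apply, _root_.smul_apply, smul_eq_mul, Finset.mul_sum]
        refine Finset.sum_congr rfl fun i _ => Finset.sum_congr rfl fun j _ => ?_
        ring
      rw [this]; exact hp _
  rw [hdet, abs_of_nonneg hps.det_nonneg]
  refine (hadamard_posSemidef G hps).trans (le_of_eq ?_)
  simp [hG]
end

/-- The sesquilinear form attached to a real bilinear form on `ℂⁿ`. -/
noncomputable def sesqForm {n : ℕ}
    (H : EuclideanSpace ℂ (Fin n) →L[ℝ] EuclideanSpace ℂ (Fin n) →L[ℝ] ℝ)
    (v w : EuclideanSpace ℂ (Fin n)) : ℂ :=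
  (1/4) * ((H v w : ℂ) + H (Complex.I • v) (Complex.I • w)
    + Complex.I * (H (Complex.I • v) w - H v (Complex.I • w)))

lemma complex_smul_eq {n : ℕ} (c : ℂ) (v : EuclideanSpace ℂ (Fin n)) :
    c • v = c.re • v + c.im • (Complex.I • v) := by
  ext i
  simp
  rw [← mul_assoc, ← add_mul, Complex.re_add_im]

lemma I_smul_I_smul {n : ℕ} (v : EuclideanSpace ℂ (Fin n)) :
    Complex.I • Complex.I • v = -v := by
  rw [smul_smul, Complex.I_mul_I, neg_one_smul]

section
variable {n : ℕ} (H : EuclideanSpace ℂ (Fin n) →L[ℝ] EuclideanSpace ℂ (Fin n) →L[ℝ] ℝ)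

lemma sesqForm_smul_right (c : ℂ) (v w : EuclideanSpace ℂ (Fin n)) :
    sesqForm H v (c • w) = c * sesqForm H v w := by
  conv_rhs => rw [← Complex.re_add_im c]
  rw [complex_smul_eq c w]
  simp only [sesqForm, smul_add, smul_comm Complex.I (_ : ℝ), I_smul_I_smul, map_add, map_smul, map_neg,
    smul_neg, smul_eq_mul]
  push_cast
  have hI : Complex.I ^ 2 = -1 := Complex.I_sq
  linear_combination (-(1/4) * (c.im : ℂ) * (H (Complex.I • v) w - H v (Complex.I • w))) * hI

lemma sesqForm_smul_left (c : ℂ) (v w : EuclideanSpace ℂ (Fin n)) :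
    sesqForm H (c • v) w = star c * sesqForm H v w := by
  have hc : star c = (c.re : ℂ) - c.im * Complex.I := by
    apply Complex.ext <;> simp
  rw [hc, complex_smul_eq c v]
  simp only [sesqForm, smul_add, smul_comm Complex.I (_ : ℝ), I_smul_I_smul, map_add, map_smul, map_neg,
    smul_neg, smul_eq_mul, _root_.add_apply, _root_.smul_apply, _root_.neg_apply]
  push_cast
  have hI : Complex.I ^ 2 = -1 := Complex.I_sq
  linear_combination ((1/4) * (c.im : ℂ) * (H (Complex.I • v) w - H v (Complex.I • w))) * hI

lemma sesqForm_sum_right {ι : Type*} (s : Finset ι) (v : EuclideanSpace ℂ (Fin n))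
    (w : ι → EuclideanSpace ℂ (Fin n)) :
    sesqForm H v (∑ i ∈ s, w i) = ∑ i ∈ s, sesqForm H v (w i) := by
  simp only [sesqForm, Finset.smul_sum, map_sum, Complex.ofReal_sum]
  rw [← Finset.sum_add_distrib, ← Finset.sum_sub_distrib, Finset.mul_sum, ← Finset.sum_add_distrib,
    Finset.mul_sum]

lemma sesqForm_sum_left {ι : Type*} (s : Finset ι) (v : EuclideanSpace ℂ (Fin n))
    (w : ι → EuclideanSpace ℂ (Fin n)) :
    sesqForm H (∑ i ∈ s, w i) v = ∑ i ∈ s, sesqForm H (w i) v := by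
  simp only [sesqForm, Finset.smul_sum, map_sum, FunLike.coe_sum, Finset.sum_apply, Complex.ofReal_sum]
  rw [← Finset.sum_add_distrib, ← Finset.sum_sub_distrib, Finset.mul_sum, ← Finset.sum_add_distrib,
    Finset.mul_sum]

lemma eucl_sum (v : EuclideanSpace ℂ (Fin n)) :
    v = ∑ i, v i • EuclideanSpace.single i (1 : ℂ) := by
  have := (EuclideanSpace.basisFun (Fin n) ℂ).sum_repr v
  simpa using this.symm

lemma sesqForm_expand (v w : EuclideanSpace ℂ (Fin n)) :
    sesqForm H v w = ∑ i, star (v i) * ∑ j,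
      sesqForm H (EuclideanSpace.single i 1) (EuclideanSpace.single j 1) * w j := by
  conv_lhs => rw [eucl_sum v, eucl_sum w]
  rw [sesqForm_sum_left]
  refine Finset.sum_congr rfl fun i _ => ?_
  rw [sesqForm_smul_left, sesqForm_sum_right]
  congr 1
  refine Finset.sum_congr rfl fun j _ => ?_
  rw [sesqForm_smul_right, mul_comm]

lemma single_I (j : Fin n) : (EuclideanSpace.single j Complex.I : EuclideanSpace ℂ (Fin n))
    = Complex.I • EuclideanSpace.single j 1 := by
  ext i; simp

lemma complexHessian_eq (u : EuclideanSpace ℂ (Fin n) → ℝ) (Ω : Set (EuclideanSpace ℂ (Fin n)))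
    (hΩ : IsOpen Ω) (hu : ContDiffOn ℝ 2 u Ω) (x : EuclideanSpace ℂ (Fin n)) (hx : x ∈ Ω)
    (i j : Fin n) :
    complexHessian u x i j = sesqForm (fderiv ℝ (fderiv ℝ u) x)
      (EuclideanSpace.single i 1) (EuclideanSpace.single j 1) := by
  have hd : ∀ y ∈ Ω, DifferentiableAt ℝ u y := fun y hy =>
    (hu.differentiableOn (by norm_num)).differentiableAt (hΩ.mem_nhds hy)
  have hd2 : DifferentiableAt ℝ (fderiv ℝ u) x :=
    ((hu.fderiv_of_isOpen (m := 1) hΩ (by norm_num)).differentiableOn (by norm_num)).differentiableAt (hΩ.mem_nhds hx)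
  have h1 : ∀ y ∈ Ω, ∀ v, fderiv ℝ (fun z => (u z : ℂ)) y v = ((fderiv ℝ u y v : ℝ) : ℂ) := by
    intro y hy v
    have := (Complex.ofRealCLM.hasFDerivAt.comp y (hd y hy).hasFDerivAt)
    have h2 : HasFDerivAt (fun z => (u z : ℂ)) (Complex.ofRealCLM.comp (fderiv ℝ u y)) y := this
    rw [h2.fderiv]; rfl
  have h2 : (wDeriv j (fun z => (u z : ℂ))) =ᶠ[nhds x] fun y =>
      (1/2) * (((fderiv ℝ u y (EuclideanSpace.single j 1) : ℝ) : ℂ)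
        - Complex.I * ((fderiv ℝ u y (EuclideanSpace.single j Complex.I) : ℝ) : ℂ)) := by
    filter_upwards [hΩ.mem_nhds hx] with y hy
    rw [wDeriv, h1 y hy, h1 y hy]
  have h3 : ∀ v, HasFDerivAt (fun y => ((fderiv ℝ u y v : ℝ) : ℂ))
      (Complex.ofRealCLM.comp ((fderiv ℝ (fderiv ℝ u) x).flip v)) x := by
    intro v
    have := hd2.hasFDerivAt.clm_apply (hasFDerivAt_const v x)
    simp only [ContinuousLinearMap.comp_zero, zero_add] at this
    exact Complex.ofRealCLM.hasFDerivAt.comp x this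
  have h4 := ((h3 (EuclideanSpace.single j 1)).sub
    ((h3 (EuclideanSpace.single j Complex.I)).const_mul Complex.I)).const_mul (1/2 : ℂ)
  have h5 : fderiv ℝ (wDeriv j (fun z => (u z : ℂ))) x = _ := h2.fderiv_eq.trans h4.fderiv
  rw [complexHessian, wBarDeriv, h5, single_I, single_I]
  simp [sesqForm]
  have hI : Complex.I ^ 2 = -1 := Complex.I_sq
  linear_combination (-(1/4) * ((fderiv ℝ (fderiv ℝ u) x (Complex.I • EuclideanSpace.single i 1) (Complex.I • EuclideanSpace.single j 1) : ℝ) : ℂ)) * hI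

lemma hessian_eigen (hs : ∀ v w, H v w = H w v) (M : Matrix (Fin n) (Fin n) ℂ)
    (hM : M.IsHermitian) (hMH : ∀ i j, M i j = sesqForm H
      (EuclideanSpace.single i 1) (EuclideanSpace.single j 1)) (k : Fin n) :
    4 * hM.eigenvalues k = H (hM.eigenvectorBasis k) (hM.eigenvectorBasis k)
      + H (Complex.I • hM.eigenvectorBasis k) (Complex.I • hM.eigenvectorBasis k) := by
  set v := hM.eigenvectorBasis k with hv
  have h1 := sesqForm_expand H v v
  have h2 := hM.mulVec_eigenvectorBasis k
  have h3 : ∀ i, ∑ j, M i j * v j = (hM.eigenvalues k : ℂ) * v i := by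
    intro i
    have := congrFun h2 i
    simpa [Matrix.mulVec, dotProduct] using this
  simp only [← hMH, h3] at h1
  have h4 : ∑ i, star (v i) * ((hM.eigenvalues k : ℂ) * v i) = hM.eigenvalues k := by
    have h5 : inner ℂ v v = 1 := by
      rw [inner_self_eq_norm_sq_to_K, hv, hM.eigenvectorBasis.norm_eq_one]; simp
    rw [PiLp.inner_apply] at h5
    calc _ = (hM.eigenvalues k : ℂ) * ∑ i, inner ℂ (v i) (v i) := by
          rw [Finset.mul_sum]
          refine Finset.sum_congr rfl fun i _ => ?_
          simp only [RCLike.inner_apply, starRingEnd_apply]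
          ring
      _ = _ := by rw [h5, mul_one]
  rw [h4, sesqForm, hs (Complex.I • v) v, sub_self, mul_zero, add_zero] at h1
  have : ((4 * hM.eigenvalues k : ℝ) : ℂ) = ((H v v + H (Complex.I • v) (Complex.I • v) : ℝ) : ℂ) := by
    push_cast
    rw [← h1]; ring
  exact_mod_cast this

lemma real_inner_eq_re (v w : EuclideanSpace ℂ (Fin n)) : inner ℝ v w = (inner ℂ v w).re := by
  simp [PiLp.inner_apply, Complex.inner]

/-- The real orthonormal basis built from a complex one. -/
lemma exists_real_basis (b : OrthonormalBasis (Fin n) ℂ (EuclideanSpace ℂ (Fin n))) :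
    ∃ b' : OrthonormalBasis (Fin n ⊕ Fin n) ℝ (EuclideanSpace ℂ (Fin n)),
      (∀ k, b' (Sum.inl k) = b k) ∧ (∀ k, b' (Sum.inr k) = Complex.I • b k) := by
  have hb := orthonormal_iff_ite.1 b.orthonormal
  have ho : Orthonormal ℝ (Sum.elim (fun k => b k) (fun k => Complex.I • b k)) := by
    rw [orthonormal_iff_ite]
    rintro (i | i) (j | j) <;>
    simp only [Sum.elim_inl, Sum.elim_inr, real_inner_eq_re, inner_smul_left, inner_smul_right, hb,
      Sum.inl.injEq, Sum.inr.injEq, reduceCtorEq, if_false] <;> split_ifs <;> simp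
  have hspan : Submodule.span ℝ (Set.range (Sum.elim (fun k => b k) (fun k => Complex.I • b k))) = ⊤ := by
    apply ho.linearIndependent.span_eq_top_of_card_eq_finrank'
    rw [finrank_real_of_complex]
    simp [two_mul]
  refine ⟨OrthonormalBasis.mk ho hspan.ge, ?_, ?_⟩ <;> intro k <;> simp

lemma det_hess_le (hs : ∀ v w, H v w = H w v) (hp : ∀ v, 0 ≤ H v v) (M : Matrix (Fin n) (Fin n) ℂ)
    (hM : M.IsHermitian) (hMH : ∀ i j, M i j = sesqForm H
      (EuclideanSpace.single i 1) (EuclideanSpace.single j 1)) :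
    (∀ k, 0 ≤ hM.eigenvalues k) ∧
    |(hessOp H).det| ≤ 2 ^ (2 * n) * (∏ k, hM.eigenvalues k) ^ 2 := by
  have he := hessian_eigen H hs M hM hMH
  constructor
  · intro k
    have := he k
    have := hp (hM.eigenvectorBasis k)
    have := hp (Complex.I • hM.eigenvectorBasis k)
    linarith
  obtain ⟨b, hb1, hb2⟩ := exists_real_basis hM.eigenvectorBasis
  refine (abs_det_hessOp_le b H hs hp).trans ?_
  rw [Fintype.prod_sum_type, ← Finset.prod_mul_distrib]
  simp only [hb1, hb2]
  have : (2:ℝ) ^ (2 * n) * (∏ k, hM.eigenvalues k) ^ 2 = ∏ k, (4 * hM.eigenvalues k ^ 2) := by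
    rw [Finset.prod_mul_distrib, Finset.prod_pow]
    simp [pow_mul]; norm_num
  rw [this]
  refine Finset.prod_le_prod (fun k _ => mul_nonneg (hp _) (hp _)) fun k _ => ?_
  have h := he k
  generalize H (hM.eigenvectorBasis k) (hM.eigenvectorBasis k) = p at h ⊢
  generalize H (Complex.I • hM.eigenvectorBasis k) (Complex.I • hM.eigenvectorBasis k) = q at h ⊢
  have h' : hM.eigenvalues k = (p + q) / 4 := by linarith
  rw [h']
  nlinarith [sq_nonneg (p - q)]
end

section
variable {E : Type*} [NormedAddCommGroup E] [InnerProductSpace ℝ E] [FiniteDimensional ℝ E]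

lemma second_deriv_nonneg {φ : ℝ → ℝ} {x : ℝ} (h : IsLocalMin φ x) (hc : ContinuousAt φ x) :
    0 ≤ deriv (deriv φ) x := by
  by_contra! hneg
  have hmax := isLocalMax_of_deriv_deriv_neg hneg h.deriv_eq_zero hc
  have hconst : φ =ᶠ[nhds x] fun _ => φ x := by
    filter_upwards [h, hmax] with t h1 h2
    exact le_antisymm h2 h1
  have : deriv (deriv φ) x = 0 := by
    rw [hconst.deriv.deriv_eq]
    simp
  linarith

lemma hess_nonneg_of_min {u : E → ℝ} {Ω : Set E} (hΩ : IsOpen Ω) (hu : ContDiffOn ℝ 2 u Ω)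
    {y : E} (hy : y ∈ Ω) (p : StrongDual ℝ E) (hmin : ∀ z ∈ Ω, u y - p y ≤ u z - p z) :
    fderiv ℝ u y = p ∧ ∀ v, 0 ≤ fderiv ℝ (fderiv ℝ u) y v v := by
  have hd : ∀ z ∈ Ω, DifferentiableAt ℝ u z := fun z hz =>
    (hu.differentiableOn (by norm_num)).differentiableAt (hΩ.mem_nhds hz)
  have hd2 : DifferentiableAt ℝ (fderiv ℝ u) y :=
    ((hu.fderiv_of_isOpen (m := 1) hΩ (by norm_num)).differentiableOn
      (by norm_num)).differentiableAt (hΩ.mem_nhds hy)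
  have hloc : IsLocalMin (fun z => u z - p z) y := by
    filter_upwards [hΩ.mem_nhds hy] with z hz using hmin z hz
  constructor
  · have h1 := hloc.fderiv_eq_zero
    have h2 : HasFDerivAt (fun z => u z - p z) (fderiv ℝ u y - p) y :=
      (hd y hy).hasFDerivAt.sub p.hasFDerivAt
    rw [h2.fderiv] at h1
    exact sub_eq_zero.1 h1
  · intro v
    have hline : ∀ t : ℝ, HasDerivAt (fun t : ℝ => y + t • v) v t := by
      intro t
      simpa using ((hasDerivAt_id t).smul_const v).const_add y
    have hcl : Continuous (fun t : ℝ => y + t • v) := by fun_prop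
    have hnear : ∀ᶠ t in nhds (0:ℝ), y + t • v ∈ Ω := by
      apply hcl.continuousAt.eventually_mem
      simpa using hΩ.mem_nhds hy
    have hder : ∀ t : ℝ, y + t • v ∈ Ω →
        HasDerivAt (fun t : ℝ => u (y + t • v) - p (y + t • v)) (fderiv ℝ u (y + t • v) v - p v) t := by
      intro t ht
      exact ((hd _ ht).hasFDerivAt.comp_hasDerivAt t (hline t)).sub
        (p.hasFDerivAt.comp_hasDerivAt t (hline t))
    have hy0 : y + (0:ℝ) • v = y := by simp
    have hm : IsLocalMin (fun t : ℝ => u (y + t • v) - p (y + t • v)) 0 := by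
      filter_upwards [hnear] with t ht
      simpa using hmin _ ht
    have h0 := second_deriv_nonneg hm (hder 0 (by simpa using hy)).continuousAt
    have h1 : deriv (fun t : ℝ => u (y + t • v) - p (y + t • v)) =ᶠ[nhds 0]
        fun t => fderiv ℝ u (y + t • v) v - p v := by
      filter_upwards [hnear] with t ht using (hder t ht).deriv
    have h2 : HasDerivAt (fun t : ℝ => fderiv ℝ u (y + t • v) v - p v)
        (fderiv ℝ (fderiv ℝ u) y v v) 0 := by
      have hd2' : HasFDerivAt (fderiv ℝ u) (fderiv ℝ (fderiv ℝ u) y) (y + (0:ℝ) • v) := by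
        rw [hy0]; exact hd2.hasFDerivAt
      have h3 := hd2'.comp_hasDerivAt (0:ℝ) (hline 0)
      have h4 := h3.clm_apply (hasDerivAt_const (0:ℝ) v)
      simpa using h4.sub_const (p v)
    rw [h1.deriv_eq, h2.deriv] at h0
    exact h0

/-- The set of points of `Ω` with nonnegative Hessian. -/
def convexPts (u : E → ℝ) (Ω : Set E) : Set E :=
  {y | y ∈ Ω ∧ ∀ v, 0 ≤ fderiv ℝ (fderiv ℝ u) y v v}

lemma measurableSet_convexPts [MeasurableSpace E] [BorelSpace E] {u : E → ℝ} {Ω : Set E}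
    (hΩ : IsOpen Ω) (hu : ContDiffOn ℝ 2 u Ω) : MeasurableSet (convexPts u Ω) := by
  have hcont : ContinuousOn (fderiv ℝ (fderiv ℝ u)) Ω :=
    (hu.fderiv_of_isOpen (m := 1) hΩ (by norm_num)).continuousOn_fderiv_of_isOpen hΩ (by norm_num)
  have hclosed : IsClosed {H : E →L[ℝ] E →L[ℝ] ℝ | ∀ v, 0 ≤ H v v} := by
    simp only [Set.setOf_forall]
    refine isClosed_iInter fun v => isClosed_le continuous_const ?_
    fun_prop
  obtain ⟨C, hC, hCe⟩ := continuousOn_iff_isClosed.1 hcont _ hclosed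
  have : convexPts u Ω = C ∩ Ω := by
    rw [← hCe]; ext y; simp [convexPts, and_comm]
  rw [this]
  exact hC.measurableSet.inter hΩ.measurableSet

lemma abp_cover {u : E → ℝ} {Ω : Set E} (hΩ : IsOpen Ω) (hb : Bornology.IsBounded Ω)
    (hu : ContDiffOn ℝ 2 u Ω) (hc : ContinuousOn u (closure Ω)) (h0 : ∀ x ∈ frontier Ω, u x = 0)
    (x₀ : E) (hx₀ : x₀ ∈ Ω) (hux : u x₀ = -1) (hd : 0 < Metric.diam Ω) :
    Metric.ball (0:E) (Metric.diam Ω)⁻¹ ⊆ (fun y => rieszInv (fderiv ℝ u y)) '' convexPts u Ω := by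
  intro q hq
  rw [mem_ball_zero_iff] at hq
  have hcomp : IsCompact (closure Ω) := hb.isCompact_closure
  set p : StrongDual ℝ E := innerSL ℝ q with hp
  have hpc : ContinuousOn (fun z => u z - p z) (closure Ω) := hc.sub p.continuous.continuousOn
  obtain ⟨y, hy, hymin⟩ := hcomp.exists_isMinOn ⟨x₀, subset_closure hx₀⟩ hpc
  have hyΩ : y ∈ Ω := by
    by_contra hn
    have hf : y ∈ frontier Ω := by rw [hΩ.frontier_eq]; exact ⟨hy, hn⟩
    have h1 : u y - p y ≤ u x₀ - p x₀ := hymin (subset_closure hx₀)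
    rw [h0 y hf, hux] at h1
    have h2 : p (y - x₀) ≤ ‖q‖ * ‖y - x₀‖ := by
      simpa [hp] using real_inner_le_norm q (y - x₀)
    have h3 : ‖y - x₀‖ ≤ Metric.diam Ω := by
      rw [← dist_eq_norm, ← Metric.diam_closure]
      exact Metric.dist_le_diam_of_mem hb.closure hy (subset_closure hx₀)
    have h4 : ‖q‖ * ‖y - x₀‖ < 1 := by
      calc ‖q‖ * ‖y - x₀‖ ≤ ‖q‖ * Metric.diam Ω := by gcongr
        _ < (Metric.diam Ω)⁻¹ * Metric.diam Ω := by gcongr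
        _ = 1 := inv_mul_cancel₀ hd.ne'
    rw [map_sub] at h2
    linarith
  obtain ⟨h1, h2⟩ := hess_nonneg_of_min hΩ hu hyΩ p (fun z hz => hymin (subset_closure hz))
  refine ⟨y, ⟨hyΩ, h2⟩, ?_⟩
  simp only [h1]
  refine ext_inner_right ℝ fun w => ?_
  rw [inner_rieszInv, hp, innerSL_apply_apply]

lemma abp_measure [MeasurableSpace E] [BorelSpace E] (μ : Measure E) [μ.IsAddHaarMeasure]
    {u : E → ℝ} {Ω : Set E} (hΩ : IsOpen Ω) (hb : Bornology.IsBounded Ω)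
    (hu : ContDiffOn ℝ 2 u Ω) (hc : ContinuousOn u (closure Ω)) (h0 : ∀ x ∈ frontier Ω, u x = 0)
    (x₀ : E) (hx₀ : x₀ ∈ Ω) (hux : u x₀ = -1) (hd : 0 < Metric.diam Ω) :
    ENNReal.ofReal ((Metric.diam Ω)⁻¹ ^ Module.finrank ℝ E) * μ (Metric.ball 0 1) ≤
      ∫⁻ x in convexPts u Ω, ENNReal.ofReal |(hessOp (fderiv ℝ (fderiv ℝ u) x)).det| ∂μ := by
  rw [← Measure.addHaar_ball_of_pos μ 0 (inv_pos.2 hd)]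
  refine (measure_mono (abp_cover hΩ hb hu hc h0 x₀ hx₀ hux hd)).trans ?_
  refine addHaar_image_le_lintegral_abs_det_fderiv μ (measurableSet_convexPts hΩ hu) ?_
  intro x hx
  have hd2 : DifferentiableAt ℝ (fderiv ℝ u) x :=
    ((hu.fderiv_of_isOpen (m := 1) hΩ (by norm_num)).differentiableOn
      (by norm_num)).differentiableAt (hΩ.mem_nhds hx.1)
  exact ((rieszInv (E := E)).hasFDerivAt.comp x hd2.hasFDerivAt).hasFDerivWithinAt
end

/-- Proposition 6.3: the Aleksandrov–Bakelman–Pucci lower bound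
`λ₁ ≥ ½ ω_{2n}^{1/2n} diam(Ω)⁻¹ ‖f‖_{L^{2n}(Ω)}⁻¹` for the first eigenvalue of the
complex `m`-Hessian operator on a bounded domain `Ω ⊂ ℂⁿ`.  The eigenvalue equation
`(√-1 ∂∂̄u)^m ∧ ω^{n-m} = (-λ₁ u)^m f^m ω^n` is expressed as
`σ_m(eigenvalues of the complex Hessian) = binom(n,m) (-λ₁ u)^m f^m`, and `μ` is any
additive Haar (Lebesgue) measure on `ℂⁿ` (the stated constant is scale-invariant). -/
theorem eigenvalue_lower_bound {n : ℕ} (hn : 1 ≤ n) (m : ℕ) (hm : 1 ≤ m) (hmn : m ≤ n)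
    [MeasurableSpace (EuclideanSpace ℂ (Fin n))] [BorelSpace (EuclideanSpace ℂ (Fin n))]
    (μ : Measure (EuclideanSpace ℂ (Fin n))) [μ.IsAddHaarMeasure]
    (Ω : Set (EuclideanSpace ℂ (Fin n))) (hΩopen : IsOpen Ω)
    (hΩbdd : Bornology.IsBounded Ω) (hΩne : Ω.Nonempty)
    (f : EuclideanSpace ℂ (Fin n) → ℝ) (hfcont : ContinuousOn f (closure Ω))
    (hfpos : ∀ x ∈ closure Ω, 0 < f x)
    (lam₁ : ℝ) (hlam : 0 < lam₁)
    (u : EuclideanSpace ℂ (Fin n) → ℝ)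
    (hu2 : ContDiffOn ℝ 2 u Ω) (hucont : ContinuousOn u (closure Ω))
    (hherm : ∀ x, x ∈ Ω → (complexHessian u x).IsHermitian)
    -- `u` is `m`-subharmonic: the eigenvalue vector of the complex Hessian lies in `Γ̄_m`
    (hmsh : ∀ x, ∀ hx : x ∈ Ω, ∀ k, 1 ≤ k → k ≤ m →
      0 ≤ esymmR n k ((hherm x hx).eigenvalues))
    -- the eigenvalue equation
    (heq : ∀ x, ∀ hx : x ∈ Ω,
      esymmR n m ((hherm x hx).eigenvalues) =
        (n.choose m : ℝ) * (-(lam₁ * u x)) ^ m * (f x) ^ m)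
    (hubd : ∀ x ∈ frontier Ω, u x = 0)
    (huneg : ∀ x ∈ Ω, u x < 0)
    (huinf : sInf (u '' Ω) = -1) :
    lam₁ ≥ (1 / 2) * ((μ (Metric.ball 0 1)).toReal) ^ ((1 : ℝ) / (2 * n)) *
      (Metric.diam Ω)⁻¹ *
      ((∫ x in Ω, (f x) ^ (2 * n) ∂μ) ^ ((1 : ℝ) / (2 * n)))⁻¹ := by
  have hcomp : IsCompact (closure Ω) := hΩbdd.isCompact_closure
  -- the minimum point
  obtain ⟨x₀, hx₀c, hx₀min⟩ := hcomp.exists_isMinOn (hΩne.mono subset_closure) hucont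
  have hx₀ : x₀ ∈ Ω := by
    by_contra hn
    have hf : x₀ ∈ frontier Ω := by rw [hΩopen.frontier_eq]; exact ⟨hx₀c, hn⟩
    obtain ⟨z, hz⟩ := hΩne
    have h1 : u x₀ ≤ u z := hx₀min (subset_closure hz)
    rw [hubd x₀ hf] at h1
    linarith [huneg z hz]
  have hleast : IsLeast (u '' Ω) (u x₀) := by
    refine ⟨⟨x₀, hx₀, rfl⟩, ?_⟩
    rintro _ ⟨z, hz, rfl⟩
    exact hx₀min (subset_closure hz)
  have hux : u x₀ = -1 := by rw [← huinf, hleast.csInf_eq]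
  have hge : ∀ x ∈ Ω, -1 ≤ u x := fun x hx => hux ▸ hx₀min (subset_closure hx)
  have hInn : 0 ≤ ∫ x in Ω, (f x) ^ (2 * n) ∂μ :=
    integral_nonneg fun x => by rw [pow_mul]; positivity
  rcases (Metric.diam_nonneg (s := Ω)).eq_or_lt with hd | hd
  · rw [← hd]; simp [hlam.le]
  have hfin : Module.finrank ℝ (EuclideanSpace ℂ (Fin n)) = 2 * n := by
    rw [finrank_real_of_complex]; simp
  have habp := abp_measure μ hΩopen hΩbdd hu2 hucont hubd x₀ hx₀ hux hd
  rw [hfin] at habp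
  -- pointwise bound on the contact set
  have hpt : ∀ x ∈ convexPts u Ω, |(hessOp (fderiv ℝ (fderiv ℝ u) x)).det| ≤
      (2 * lam₁) ^ (2 * n) * (f x) ^ (2 * n) := by
    intro x hx
    have hxΩ := hx.1
    have hf := hfpos x (subset_closure hxΩ)
    have hs : ∀ v w, fderiv ℝ (fderiv ℝ u) x v w = fderiv ℝ (fderiv ℝ u) x w v := fun v w =>
      (hu2.contDiffAt (hΩopen.mem_nhds hxΩ)).isSymmSndFDerivAt (by simp) v w
    obtain ⟨hev, hdet⟩ := det_hess_le (fderiv ℝ (fderiv ℝ u) x) hs hx.2 _ (hherm x hxΩ)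
      (complexHessian_eq u Ω hΩopen hu2 x hxΩ)
    have hu0 := huneg x hxΩ
    have hu1 := hge x hxΩ
    have ht : 0 ≤ -(lam₁ * u x) * f x := mul_nonneg (by nlinarith) hf.le
    have hmac := maclaurin_prod hm hmn _ hev (-(lam₁ * u x) * f x) ht
      (by rw [heq x hxΩ, mul_pow, mul_assoc])
    have ht' : -(lam₁ * u x) * f x ≤ lam₁ * f x := by
      refine mul_le_mul_of_nonneg_right ?_ hf.le
      nlinarith
    have hP : ∏ i, (hherm x hxΩ).eigenvalues i ≤ (lam₁ * f x) ^ n :=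
      hmac.trans (pow_le_pow_left₀ ht ht' n)
    have hP0 : 0 ≤ ∏ i, (hherm x hxΩ).eigenvalues i := Finset.prod_nonneg fun i _ => hev i
    calc _ ≤ _ := hdet
      _ ≤ 2 ^ (2 * n) * ((lam₁ * f x) ^ n) ^ 2 := by gcongr
      _ = _ := by rw [← pow_mul, mul_comm n 2, mul_pow, mul_pow]; ring
  have hIntegr : IntegrableOn (fun x => (2 * lam₁) ^ (2 * n) * (f x) ^ (2 * n)) Ω μ :=
    ((continuousOn_const.mul (hfcont.pow _)).integrableOn_compact hcomp).mono_set subset_closure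
  have hmain : ENNReal.ofReal ((Metric.diam Ω)⁻¹ ^ (2 * n)) * μ (Metric.ball 0 1) ≤
      ENNReal.ofReal ((2 * lam₁) ^ (2 * n) * ∫ x in Ω, (f x) ^ (2 * n) ∂μ) := by
    refine habp.trans ?_
    rw [← integral_const_mul, ofReal_integral_eq_lintegral_ofReal hIntegr
      (Filter.Eventually.of_forall fun x => by simp only [Pi.zero_apply, pow_mul]; positivity)]
    refine (setLIntegral_mono' (measurableSet_convexPts hΩopen hu2) (fun x hx =>
      ENNReal.ofReal_le_ofReal (hpt x hx))).trans ?_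
    exact lintegral_mono_set (fun x hx => hx.1)
  set I := ∫ x in Ω, (f x) ^ (2 * n) ∂μ with hI
  set B := (μ (Metric.ball 0 1)).toReal with hB
  have hB0 : 0 ≤ B := ENNReal.toReal_nonneg
  have hreal : (Metric.diam Ω)⁻¹ ^ (2 * n) * B ≤ (2 * lam₁) ^ (2 * n) * I := by
    have h := ENNReal.toReal_mono ENNReal.ofReal_ne_top hmain
    rwa [ENNReal.toReal_mul, ENNReal.toReal_ofReal (by positivity),
      ENNReal.toReal_ofReal (by positivity)] at h
  have hroot : ∀ a : ℝ, 0 ≤ a → (a ^ ((1:ℝ) / (2 * n))) ^ (2 * n) = a := by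
    intro a ha
    have hn' : (2 * (n:ℝ)) ≠ 0 := by positivity
    rw [← Real.rpow_natCast, ← Real.rpow_mul ha]
    push_cast
    rw [one_div, inv_mul_cancel₀ hn', Real.rpow_one]
  have hb0 : 0 ≤ B ^ ((1:ℝ) / (2 * n)) := Real.rpow_nonneg hB0 _
  have hi0 : 0 ≤ I ^ ((1:ℝ) / (2 * n)) := Real.rpow_nonneg hInn _
  have hbr := hroot B hB0
  have hir := hroot I hInn
  generalize B ^ ((1:ℝ) / (2 * n)) = b at *
  generalize I ^ ((1:ℝ) / (2 * n)) = i at *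
  rw [← hbr, ← hir, ← mul_pow, ← mul_pow] at hreal
  have hle := le_of_pow_le_pow_left₀ (by omega) (by positivity) hreal
  rcases hi0.eq_or_lt with h0 | h0
  · rw [← h0]; simp [hlam.le]
  · rw [ge_iff_le, mul_inv_le_iff₀ h0]
    nlinarith
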